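/- Assume (P₂) and (Q₂). Then the best constant S_q := inf{‖u‖_{s,p}/‖u‖_{L^{q(·)}(ℝ^N)} : u ∈ W^{s,p(·,·)}(ℝ^N), u ≠ 0} is strictly positive. -/

import Mathlib

open MeasureTheory Filter Topology Set
open scoped ENNReal NNReal

noncomputable section

/-- Euclidean space `ℝ^N`. -/
abbrev Euc (N : ℕ) := EuclideanSpace ℝ (Fin N)

/-- The modular of the variable exponent Lebesgue space `L^{h(·)}_μ`. -/
def varModular {α : Type*} [MeasurableSpace α] (μ : Measure α) (h : α → ℝ) (u : α → ℝ) : ℝ≥0∞ :=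
  ∫⁻ x, ENNReal.ofReal (|u x| ^ (h x)) ∂μ

/-- The Luxemburg norm on the variable exponent Lebesgue space `L^{h(·)}_μ`. -/
def luxNorm {α : Type*} [MeasurableSpace α] (μ : Measure α) (h : α → ℝ) (u : α → ℝ) : ℝ :=
  sInf {c : ℝ | 0 < c ∧ varModular μ h (fun x => u x / c) ≤ 1}

/-- Membership in the variable exponent Lebesgue space `L^{h(·)}_μ`. -/
def MemVarLp {α : Type*} [MeasurableSpace α] (μ : Measure α) (h : α → ℝ) (u : α → ℝ) : Prop :=
  AEStronglyMeasurable u μ ∧ varModular μ h u < ⊤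

/-- The integrand of the Gagliardo-type seminorm with variable exponent. -/
def sobKernel {N : ℕ} (s : ℝ) (p : Euc N → Euc N → ℝ) (u : Euc N → ℝ) (x y : Euc N) : ℝ≥0∞ :=
  ENNReal.ofReal (|u x - u y| ^ (p x y) / dist x y ^ ((N : ℝ) + s * p x y))

/-- The modular of the fractional Sobolev space `W^{s,p(·,·)}(Ω)`. -/
def sobModular {N : ℕ} (Ω : Set (Euc N)) (s : ℝ) (p : Euc N → Euc N → ℝ)
    (u : Euc N → ℝ) : ℝ≥0∞ :=
  (∫⁻ x in Ω, ENNReal.ofReal (|u x| ^ (p x x))) + ∫⁻ x in Ω, ∫⁻ y in Ω, sobKernel s p u x y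

/-- The Luxemburg-type norm of the fractional Sobolev space `W^{s,p(·,·)}(Ω)`. -/
def sobNorm {N : ℕ} (Ω : Set (Euc N)) (s : ℝ) (p : Euc N → Euc N → ℝ) (u : Euc N → ℝ) : ℝ :=
  sInf {c : ℝ | 0 < c ∧ sobModular Ω s p (fun x => u x / c) ≤ 1}

/-- Membership in the fractional Sobolev space `W^{s,p(·,·)}(Ω)`. -/
def MemSob {N : ℕ} (Ω : Set (Euc N)) (s : ℝ) (p : Euc N → Euc N → ℝ) (u : Euc N → ℝ) : Prop :=
  AEStronglyMeasurable u (volume.restrict Ω) ∧ sobModular Ω s p u < ⊤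

/-- The best constant `S_q` of the imbedding `W^{s,p(·,·)}(ℝ^N) ↪ L^{q(·)}(ℝ^N)`. -/
def Sq {N : ℕ} (s : ℝ) (p : Euc N → Euc N → ℝ) (q : Euc N → ℝ) : ℝ :=
  sInf {c : ℝ | ∃ u : Euc N → ℝ, MemSob Set.univ s p u ∧ ¬ u =ᵐ[volume] 0 ∧
    c = sobNorm Set.univ s p u / luxNorm volume q u}

def locE {N : ℕ} (s P ε : ℝ) (v : Euc N → ℝ) (x : Euc N) : ℝ≥0∞ :=
  ∫⁻ y in Metric.ball x ε, ENNReal.ofReal (|v x - v y| ^ P / dist x y ^ ((N : ℝ) + s * P))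

lemma locE_lower {N : ℕ} (hN : 0 < N) {s P Q ε : ℝ} (hs : 0 < s) (hP : 0 < P) (hQ : 0 < Q)
    {v : Euc N → ℝ} (hv : AEMeasurable v) (hv0 : ∀ x, 0 ≤ v x)
    {a ω : ℝ} (ha : 0 < a) (hω : 0 < ω) (hωv : volume (Metric.ball (0 : Euc N) 1) = ENNReal.ofReal ω)
    (hA : ∫⁻ x, ENNReal.ofReal (v x ^ Q) ≤ ENNReal.ofReal a)
    (x : Euc N) (ht : 0 < v x) {r : ℝ} (hr : 0 < r) (hrε : r ≤ ε)
    (hra : ω * r ^ N * (v x / 2) ^ Q = 4 * a) :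
    ENNReal.ofReal ((v x / 2) ^ P * r ^ (-(s * P)) * (ω / 2)) ≤ locE s P ε v x := by
  set t := v x with htdef
  have ht2 : 0 < (t / 2) ^ Q := by positivity
  set B := Metric.ball x r
  have hB : volume B = ENNReal.ofReal (ω * r ^ N) := by
    have := Measure.addHaar_ball_of_pos (volume : Measure (Euc N)) x hr
    rw [this, hωv, ← ENNReal.ofReal_mul (by positivity)]
    simp [mul_comm]
  set S := {y : Euc N | ENNReal.ofReal ((t / 2) ^ Q) ≤ ENNReal.ofReal (v y ^ Q)}
  have hmeas : AEMeasurable (fun y => ENNReal.ofReal (v y ^ Q)) := by fun_prop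
  have hSm : NullMeasurableSet S := nullMeasurableSet_le aemeasurable_const hmeas
  have hS : volume S ≤ ENNReal.ofReal (ω * r ^ N / 4) := by
    have h1 : ENNReal.ofReal ((t / 2) ^ Q) * volume S ≤ ENNReal.ofReal a :=
      (mul_meas_ge_le_lintegral₀ hmeas _).trans hA
    have h2 : ENNReal.ofReal a = ENNReal.ofReal ((t / 2) ^ Q) * ENNReal.ofReal (ω * r ^ N / 4) := by
      rw [← ENNReal.ofReal_mul ht2.le]; congr 1; linarith
    rw [h2] at h1
    exact (ENNReal.mul_le_mul_iff_right (by simpa using ht2) ENNReal.ofReal_ne_top).1 h1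
  have hT : ENNReal.ofReal (ω * r ^ N / 2) ≤ volume (B \ S) := by
    refine le_trans ?_ le_measure_sdiff
    rw [hB]
    calc ENNReal.ofReal (ω * r ^ N / 2) ≤ ENNReal.ofReal (ω * r ^ N - ω * r ^ N / 4) := by
          apply ENNReal.ofReal_le_ofReal
          have : 0 < ω * r ^ N := by positivity
          linarith
      _ = ENNReal.ofReal (ω * r ^ N) - ENNReal.ofReal (ω * r ^ N / 4) := by
          rw [ENNReal.ofReal_sub _ (by positivity)]
      _ ≤ _ := tsub_le_tsub_left hS _
  have hTm : NullMeasurableSet (B \ S) := measurableSet_ball.nullMeasurableSet.diff hSm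
  have hk : ∀ y ∈ B \ S, ENNReal.ofReal ((t / 2) ^ P / r ^ ((N : ℝ) + s * P)) ≤
      ENNReal.ofReal (|v x - v y| ^ P / dist x y ^ ((N : ℝ) + s * P)) := by
    rintro y ⟨hyB, hyS⟩
    have h1 : v y < t / 2 := by
      by_contra! h
      apply hyS
      exact ENNReal.ofReal_le_ofReal (Real.rpow_le_rpow (by positivity) h hQ.le)
    have hxy : 0 < dist x y := by
      apply dist_pos.2
      rintro rfl
      linarith
    have hd : dist x y ≤ r := by rw [dist_comm]; exact (Metric.mem_ball.1 hyB).le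
    apply ENNReal.ofReal_le_ofReal
    have : t / 2 ≤ |v x - v y| := le_trans (by linarith) (le_abs_self _)
    gcongr
  calc ENNReal.ofReal ((t / 2) ^ P * r ^ (-(s * P)) * (ω / 2))
      = ENNReal.ofReal ((t / 2) ^ P / r ^ ((N : ℝ) + s * P)) * ENNReal.ofReal (ω * r ^ N / 2) := by
        rw [← ENNReal.ofReal_mul (by positivity)]
        congr 1
        rw [Real.rpow_neg hr.le, Real.rpow_add hr, Real.rpow_natCast]
        field_simp
    _ ≤ ENNReal.ofReal ((t / 2) ^ P / r ^ ((N : ℝ) + s * P)) * volume (B \ S) := by gcongr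
    _ = ∫⁻ y in B \ S, ENNReal.ofReal ((t / 2) ^ P / r ^ ((N : ℝ) + s * P)) := by
        rw [setLIntegral_const]
    _ ≤ ∫⁻ y in B \ S, ENNReal.ofReal (|v x - v y| ^ P / dist x y ^ ((N : ℝ) + s * P)) := by
        apply lintegral_mono_ae
        filter_upwards [ae_restrict_mem₀ hTm] with y hy using hk y hy
    _ ≤ _ := lintegral_mono_set (sdiff_subset.trans (Metric.ball_subset_ball hrε))

lemma locE_ptwise {N : ℕ} (hN : 0 < N) {s P ε : ℝ} (hs : 0 < s) (hP : 1 < P) (hsP : s * P < N)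
    (hε : 0 < ε) {Q : ℝ} (hQ : Q = N * P / (N - s * P)) :
    ∃ c1 : ℝ, 0 < c1 ∧ ∀ (v : Euc N → ℝ), AEMeasurable v → (∀ x, 0 ≤ v x) →
      ∀ a : ℝ, 0 < a → ∫⁻ x, ENNReal.ofReal (v x ^ Q) ≤ ENNReal.ofReal a → ∀ x,
      ENNReal.ofReal (c1 * a ^ (-(s * P / N)) * v x ^ Q) ≤
        locE s P ε v x + ENNReal.ofReal (ε ^ (-(s * P)) * v x ^ P) := by
  have hN' : (0 : ℝ) < N := by exact_mod_cast hN
  have hD : 0 < (N : ℝ) - s * P := by linarith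
  have hQ0 : 0 < Q := by rw [hQ]; positivity
  obtain ⟨ω, hω, hωv⟩ : ∃ ω : ℝ, 0 < ω ∧
      volume (Metric.ball (0 : Euc N) 1) = ENNReal.ofReal ω := by
    have h0 := Metric.measure_ball_pos (volume : Measure (Euc N)) 0 one_pos
    have h1 : volume (Metric.ball (0 : Euc N) 1) < ⊤ := measure_ball_lt_top
    exact ⟨_, ENNReal.toReal_pos h0.ne' h1.ne, (ENNReal.ofReal_toReal h1.ne).symm⟩
  set θ := s * P / N with hθ
  have hθ0 : 0 < θ := by positivity
  have hQθ : P + Q * θ = Q := by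
    have e : Q * (N - s * P) = N * P := by rw [hQ, div_mul_cancel₀ _ hD.ne']
    rw [hθ]; field_simp; linarith
  set c0 := min 1 ((1 / 2) ^ P * (ω / 2)) with hc0
  have hc0p : 0 < c0 := by positivity
  set κ := 4 * 2 ^ Q / ω with hκ
  have hκp : 0 < κ := by positivity
  refine ⟨c0 * κ ^ (-θ), by positivity, ?_⟩
  intro v hv hv0 a ha hA x
  rcases (hv0 x).eq_or_lt with ht | ht
  · rw [← ht, Real.zero_rpow hQ0.ne']; simp
  set t := v x with htd
  set ρ := κ * a / t ^ Q with hρ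
  have hρp : 0 < ρ := by positivity
  set r := ρ ^ (1 / (N : ℝ)) with hrd
  have hr : 0 < r := by positivity
  have hrN : r ^ N = ρ := by
    rw [hrd, ← Real.rpow_natCast, ← Real.rpow_mul hρp.le]
    field_simp
    simp
  have hrs : r ^ (-(s * P)) = ρ ^ (-θ) := by
    rw [hrd, ← Real.rpow_mul hρp.le]
    congr 1; rw [hθ]; field_simp
  have key : c0 * κ ^ (-θ) * a ^ (-θ) * t ^ Q = c0 * (t ^ P * r ^ (-(s * P))) := by
    rw [hrs, hρ, Real.div_rpow (mul_pos hκp ha).le (Real.rpow_pos_of_pos ht Q).le,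
      Real.mul_rpow hκp.le ha.le,
      ← Real.rpow_mul ht.le]
    have : t ^ Q = t ^ P / t ^ (Q * -θ) := by
      rw [← Real.rpow_sub ht]; congr 1; linarith
    rw [this]; field_simp
  rw [key]
  rcases le_or_gt r ε with h | h
  · have := locE_lower hN hs (zero_lt_one.trans hP) hQ0 hv hv0 ha hω hωv hA x ht hr h (by
      rw [hrN, hρ, hκ, ← htd, Real.div_rpow ht.le (by norm_num)]
      field_simp)
    refine le_trans ?_ (le_trans this le_self_add)
    apply ENNReal.ofReal_le_ofReal
    rw [← htd, Real.div_rpow ht.le (by norm_num)]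
    calc c0 * (t ^ P * r ^ (-(s * P))) ≤ ((1 / 2) ^ P * (ω / 2)) * (t ^ P * r ^ (-(s * P))) := by
          gcongr; exact min_le_right _ _
      _ = _ := by rw [Real.div_rpow (by norm_num) (by norm_num), Real.one_rpow]; ring
  · refine le_trans ?_ le_add_self
    apply ENNReal.ofReal_le_ofReal
    have h1 : r ^ (-(s * P)) ≤ ε ^ (-(s * P)) :=
      Real.rpow_le_rpow_of_nonpos hε h.le (by have := mul_pos hs (by linarith : 0 < P); linarith)
    calc c0 * (t ^ P * r ^ (-(s * P))) ≤ 1 * (t ^ P * ε ^ (-(s * P))) := by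
          gcongr; exact min_le_left _ _
      _ = _ := by ring

lemma frac_sob_bdd {N : ℕ} (hN : 0 < N) {s P ε : ℝ} (hs : 0 < s) (hP : 1 < P) (hsP : s * P < N)
    (hε : 0 < ε) {Q : ℝ} (hQ : Q = N * P / (N - s * P)) :
    ∃ C : ℝ, 0 < C ∧ ∀ (v : Euc N → ℝ), AEMeasurable v → (∀ x, 0 ≤ v x) →
      ∫⁻ x, ENNReal.ofReal (v x ^ Q) < ⊤ →
      (∫⁻ x, ENNReal.ofReal (v x ^ P)) + ∫⁻ x, locE s P ε v x ≤ 1 →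
      ∫⁻ x, ENNReal.ofReal (v x ^ Q) ≤ ENNReal.ofReal C := by
  have hN' : (0 : ℝ) < N := by exact_mod_cast hN
  obtain ⟨c1, hc1, H⟩ := locE_ptwise hN hs hP hsP hε hQ
  set θ := s * P / N with hθ
  have hθ1 : 0 < 1 - θ := by
    rw [hθ, sub_pos, div_lt_one hN']; exact hsP
  set K := 1 + ε ^ (-(s * P)) with hK
  have hKp : 0 < K := by positivity
  refine ⟨(K / c1) ^ (1 / (1 - θ)), by positivity, ?_⟩
  intro v hv hv0 hfin hle
  set A := ∫⁻ x, ENNReal.ofReal (v x ^ Q) with hA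
  rcases eq_or_ne A 0 with h0 | h0
  · rw [h0]; exact zero_le
  set a := A.toReal with had
  have ha : 0 < a := ENNReal.toReal_pos h0 hfin.ne
  have hAa : A = ENNReal.ofReal a := (ENNReal.ofReal_toReal hfin.ne).symm
  have h1 := lintegral_mono (μ := volume) (H v hv hv0 a ha hAa.le)
  have hI1 : (∫⁻ x, ENNReal.ofReal (v x ^ P)) ≤ 1 := le_trans le_self_add hle
  have hI2 : (∫⁻ x, locE s P ε v x) ≤ 1 := le_trans le_add_self hle
  rw [lintegral_add_right' _ (by fun_prop)] at h1
  have e1 : ∫⁻ x, ENNReal.ofReal (c1 * a ^ (-θ) * v x ^ Q) = ENNReal.ofReal (c1 * a ^ (-θ)) * A := by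
    rw [hA, ← lintegral_const_mul'' _ (by fun_prop)]
    congr 1; ext x
    rw [ENNReal.ofReal_mul (by positivity)]
  have e2 : ∫⁻ x, ENNReal.ofReal (ε ^ (-(s * P)) * v x ^ P) ≤ ENNReal.ofReal (ε ^ (-(s * P))) := by
    calc _ = ENNReal.ofReal (ε ^ (-(s * P))) * ∫⁻ x, ENNReal.ofReal (v x ^ P) := by
          rw [← lintegral_const_mul'' _ (by fun_prop)]
          congr 1; ext x
          rw [ENNReal.ofReal_mul (by positivity)]
      _ ≤ ENNReal.ofReal (ε ^ (-(s * P))) * 1 := by gcongr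
      _ = _ := mul_one _
  rw [e1] at h1
  have h2 : ENNReal.ofReal (c1 * a ^ (1 - θ)) ≤ ENNReal.ofReal K := by
    calc ENNReal.ofReal (c1 * a ^ (1 - θ)) = ENNReal.ofReal (c1 * a ^ (-θ)) * A := by
          rw [hAa, ← ENNReal.ofReal_mul (by positivity)]
          congr 1
          rw [show 1 - θ = -θ + 1 by ring, Real.rpow_add_one ha.ne']; ring
      _ ≤ 1 + ENNReal.ofReal (ε ^ (-(s * P))) := h1.trans (add_le_add hI2 e2)
      _ = _ := by rw [hK, ENNReal.ofReal_add (by norm_num) (by positivity), ENNReal.ofReal_one]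
  rw [ENNReal.ofReal_le_ofReal_iff hKp.le] at h2
  rw [hAa]
  apply ENNReal.ofReal_le_ofReal
  have h3 : a ^ (1 - θ) ≤ K / c1 := by rw [le_div_iff₀ hc1]; linarith
  calc a = (a ^ (1 - θ)) ^ (1 / (1 - θ)) := by
        rw [← Real.rpow_mul ha.le, mul_one_div_cancel hθ1.ne', Real.rpow_one]
    _ ≤ _ := by gcongr

lemma frac_sob {N : ℕ} (hN : 0 < N) {s P ε : ℝ} (hs : 0 < s) (hP : 1 < P) (hsP : s * P < N)
    (hε : 0 < ε) {Q : ℝ} (hQ : Q = N * P / (N - s * P)) :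
    ∃ C : ℝ, 0 < C ∧ ∀ (u : Euc N → ℝ), AEMeasurable u →
      (∫⁻ x, ENNReal.ofReal (|u x| ^ P)) + ∫⁻ x, locE s P ε u x ≤ 1 →
      ∫⁻ x, ENNReal.ofReal (|u x| ^ Q) ≤ ENNReal.ofReal C := by
  have hN' : (0 : ℝ) < N := by exact_mod_cast hN
  have hD : 0 < (N : ℝ) - s * P := by linarith
  have hQ0 : 0 < Q := by rw [hQ]; positivity
  have hPQ : P ≤ Q := by
    rw [hQ, le_div_iff₀ hD]
    nlinarith [mul_pos hs (by linarith : 0 < P)]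
  obtain ⟨C, hC, H⟩ := frac_sob_bdd hN hs hP hsP hε hQ
  refine ⟨C, hC, ?_⟩
  intro u hu hle
  have hk : ∀ k : ℕ, ∫⁻ x, ENNReal.ofReal ((min |u x| k) ^ Q) ≤ ENNReal.ofReal C := by
    intro k
    apply H
    · exact (measurable_norm.comp_aemeasurable hu).min aemeasurable_const
    · intro x; positivity
    · have : ∀ x, ENNReal.ofReal ((min |u x| k) ^ Q) ≤
          ENNReal.ofReal ((k : ℝ) ^ (Q - P)) * ENNReal.ofReal (|u x| ^ P) := by
        intro x
        rw [← ENNReal.ofReal_mul (by positivity)]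
        apply ENNReal.ofReal_le_ofReal
        have h0 : 0 ≤ min |u x| (k : ℝ) := by positivity
        calc (min |u x| (k : ℝ)) ^ Q = (min |u x| (k : ℝ)) ^ (Q - P) * (min |u x| (k : ℝ)) ^ P := by
              rw [← Real.rpow_add_of_nonneg h0 (by linarith) (by linarith)]; congr 1; ring
          _ ≤ _ := by
              gcongr
              · exact min_le_right _ _
              · exact min_le_left _ _
      refine (lintegral_mono this).trans_lt ?_
      rw [lintegral_const_mul' _ _ ENNReal.ofReal_ne_top]
      exact ENNReal.mul_lt_top ENNReal.ofReal_lt_top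
        ((le_self_add.trans hle).trans_lt ENNReal.one_lt_top)
    · refine le_trans (add_le_add ?_ ?_) hle
      · apply lintegral_mono; intro x
        apply ENNReal.ofReal_le_ofReal
        have h0 : 0 ≤ min |u x| (k : ℝ) := by positivity
        gcongr
        exact min_le_left _ _
      · apply lintegral_mono; intro x
        apply lintegral_mono; intro y
        apply ENNReal.ofReal_le_ofReal
        have : |min |u x| (k:ℝ) - min |u y| (k:ℝ)| ≤ |u x - u y| :=
          (abs_min_sub_min_le_max _ _ _ _).trans (by
            simp only [sub_self, abs_zero]
            exact max_le (abs_abs_sub_abs_le _ _) (abs_nonneg _))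
        dsimp only
        gcongr
  have hlim : ∀ x, ENNReal.ofReal (|u x| ^ Q) ≤
      liminf (fun k : ℕ => ENNReal.ofReal ((min |u x| k) ^ Q)) atTop := by
    intro x
    apply le_of_eq
    symm
    apply Tendsto.liminf_eq
    apply tendsto_const_nhds.congr'
    obtain ⟨n, hn⟩ := exists_nat_ge |u x|
    filter_upwards [eventually_ge_atTop n] with k hk
    rw [min_eq_left (hn.trans (by exact_mod_cast hk))]
  calc ∫⁻ x, ENNReal.ofReal (|u x| ^ Q)
      ≤ ∫⁻ x, liminf (fun k : ℕ => ENNReal.ofReal ((min |u x| k) ^ Q)) atTop := lintegral_mono hlim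
    _ ≤ liminf (fun k : ℕ => ∫⁻ x, ENNReal.ofReal ((min |u x| k) ^ Q)) atTop := by
        apply lintegral_liminf_le'
        intro k
        have := (measurable_norm.comp_aemeasurable hu).min (aemeasurable_const (b := (k:ℝ)))
        exact (this.pow_const Q).ennreal_ofReal
    _ ≤ ENNReal.ofReal C := by
        apply liminf_le_of_le
        · isBoundedDefault
        · intro b hb
          obtain ⟨k, hb⟩ := hb.exists
          exact hb.trans (hk k)

lemma abs_div_rpow_le {x a h : ℝ} (ha : 1 ≤ a) (hh : 1 ≤ h) : |x / a| ^ h ≤ (1 / a) * |x| ^ h := by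
  have ha0 : 0 < a := by linarith
  rw [abs_div, abs_of_pos ha0, Real.div_rpow (abs_nonneg _) ha0.le, div_eq_mul_one_div, mul_comm]
  gcongr
  calc a = a ^ (1:ℝ) := (Real.rpow_one a).symm
    _ ≤ _ := Real.rpow_le_rpow_of_exponent_le ha hh

lemma varModular_div_le {α : Type*} [MeasurableSpace α] (μ : Measure α) {h : α → ℝ}
    (hh : ∀ x, 1 ≤ h x) (u : α → ℝ) {a : ℝ} (ha : 1 ≤ a) :
    varModular μ h (fun x => u x / a) ≤ ENNReal.ofReal (1 / a) * varModular μ h u := by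
  unfold varModular
  rw [← lintegral_const_mul' _ _ ENNReal.ofReal_ne_top]
  apply lintegral_mono
  intro x
  dsimp only
  rw [← ENNReal.ofReal_mul (by positivity)]
  exact ENNReal.ofReal_le_ofReal (abs_div_rpow_le ha (hh x))

lemma sobModular_div_le {N : ℕ} (Ω : Set (Euc N)) (s : ℝ) {p : Euc N → Euc N → ℝ}
    (hp : ∀ x y, 1 ≤ p x y) (u : Euc N → ℝ) {a : ℝ} (ha : 1 ≤ a) :
    sobModular Ω s p (fun x => u x / a) ≤ ENNReal.ofReal (1 / a) * sobModular Ω s p u := by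
  unfold sobModular sobKernel
  rw [mul_add]
  apply add_le_add
  · rw [← lintegral_const_mul' _ _ ENNReal.ofReal_ne_top]
    apply lintegral_mono
    intro x
    dsimp only
    rw [← ENNReal.ofReal_mul (by positivity)]
    exact ENNReal.ofReal_le_ofReal (abs_div_rpow_le ha (hp x x))
  · rw [← lintegral_const_mul' _ _ ENNReal.ofReal_ne_top]
    apply lintegral_mono
    intro x
    dsimp only
    rw [← lintegral_const_mul' _ _ ENNReal.ofReal_ne_top]
    apply lintegral_mono
    intro y
    dsimp only
    rw [← ENNReal.ofReal_mul (by positivity), ← sub_div, ← mul_div_assoc]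
    apply ENNReal.ofReal_le_ofReal
    gcongr
    exact abs_div_rpow_le ha (hp x y)

def radG (N : ℕ) (s : ℝ) (t : ℝ) : ℝ :=
  if t < 1 then t ^ ((1 - s) - (N : ℝ)) else t ^ (-(N : ℝ) - s)

lemma radG_int {N : ℕ} (hN : 0 < N) {s : ℝ} (hs : s ∈ Set.Ioo (0:ℝ) 1) :
    Integrable (fun z : Euc N => radG N s ‖z‖) := by
  haveI : Nonempty (Fin N) := ⟨⟨0, hN⟩⟩
  rw [integrable_fun_norm_addHaar (volume : Measure (Euc N)) (f := radG N s)]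
  rw [finrank_euclideanSpace_fin, ← Ioo_union_Ici_eq_Ioi (zero_lt_one (α := ℝ))]
  have hpow : ∀ y : ℝ, 0 < y → y ^ (N - 1) = y ^ ((N : ℝ) - 1) := by
    intro y hy
    rw [← Real.rpow_natCast, Nat.cast_sub hN, Nat.cast_one]
  apply IntegrableOn.union
  · have h1 : IntegrableOn (fun y : ℝ => y ^ (-s)) (Ioo 0 1) := by
      rw [intervalIntegral.integrableOn_Ioo_rpow_iff one_pos]; linarith [hs.2]
    refine h1.congr_fun ?_ measurableSet_Ioo
    intro y hy
    simp only [radG, if_pos hy.2, smul_eq_mul]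
    rw [hpow y hy.1, ← Real.rpow_add hy.1]; congr 1; ring
  · rw [integrableOn_Ici_iff_integrableOn_Ioi]
    have h1 : IntegrableOn (fun y : ℝ => y ^ (-1 - s)) (Ioi 1) :=
      integrableOn_Ioi_rpow_of_lt (by linarith [hs.1]) one_pos
    refine h1.congr_fun ?_ measurableSet_Ioi
    intro y hy
    have hy' : (1:ℝ) < y := hy
    simp only [radG, if_neg hy'.not_gt, smul_eq_mul]
    rw [hpow y (by linarith), ← Real.rpow_add (by linarith)]; congr 1; ring

def tent (N : ℕ) (x : Euc N) : ℝ := max (1 - ‖x‖) 0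

lemma tent_cont (N : ℕ) : Continuous (tent N) := by unfold tent; fun_prop

lemma tent_zero {N : ℕ} {x : Euc N} (hx : x ∉ Metric.ball (0 : Euc N) 1) : tent N x = 0 := by
  have : 1 ≤ ‖x‖ := by simpa using hx
  unfold tent; apply max_eq_right; linarith

lemma tent_nonneg {N : ℕ} (x : Euc N) : 0 ≤ tent N x := le_max_right _ _

lemma tent_le {N : ℕ} (x : Euc N) : tent N x ≤ 1 := by
  unfold tent; apply max_le <;> linarith [norm_nonneg x]

lemma tent_lip {N : ℕ} (x y : Euc N) : |tent N x - tent N y| ≤ dist x y := by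
  unfold tent
  refine (abs_max_sub_max_le_abs _ _ _).trans ?_
  rw [show 1 - ‖x‖ - (1 - ‖y‖) = ‖y‖ - ‖x‖ by ring, dist_comm, dist_eq_norm]
  exact abs_norm_sub_norm_le _ _

lemma tent_kernel {N : ℕ} {s : ℝ} (hs : s ∈ Set.Ioo (0:ℝ) 1) {p : Euc N → Euc N → ℝ}
    (hp : ∀ x y, 1 ≤ p x y) (x y : Euc N) :
    sobKernel s p (tent N) x y ≤
      (Metric.ball (0 : Euc N) 1).indicator 1 x * ENNReal.ofReal (radG N s ‖x - y‖) +
      (Metric.ball (0 : Euc N) 1).indicator 1 y * ENNReal.ofReal (radG N s ‖x - y‖) := by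
  have hp1 := hp x y
  by_cases hxy : x ∉ Metric.ball (0 : Euc N) 1 ∧ y ∉ Metric.ball (0 : Euc N) 1
  · unfold sobKernel
    rw [tent_zero hxy.1, tent_zero hxy.2, sub_zero, abs_zero, Real.zero_rpow (by linarith)]
    simp
  have main : sobKernel s p (tent N) x y ≤ ENNReal.ofReal (radG N s ‖x - y‖) := by
    unfold sobKernel
    rcases eq_or_ne x y with rfl | hne
    · rw [sub_self, abs_zero, Real.zero_rpow (by linarith)]; simp
    apply ENNReal.ofReal_le_ofReal
    rw [← dist_eq_norm]
    have hd : 0 < dist x y := dist_pos.2 hne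
    have h1 := tent_lip x y
    have h2 : |tent N x - tent N y| ≤ 1 := by
      rw [abs_le]; constructor <;> linarith [tent_nonneg x, tent_nonneg y, tent_le x, tent_le y]
    unfold radG
    split_ifs with h
    · calc _ ≤ dist x y ^ (p x y) / dist x y ^ ((N : ℝ) + s * p x y) := by gcongr
        _ = dist x y ^ ((1 - s) * p x y - N) := by
          rw [← Real.rpow_sub hd]; congr 1; ring
        _ ≤ _ := Real.rpow_le_rpow_of_exponent_ge hd h.le (by nlinarith [hs.2])
    · calc _ ≤ (1:ℝ) ^ (p x y) / dist x y ^ ((N : ℝ) + s * p x y) := by gcongr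
        _ = dist x y ^ (-(N : ℝ) - s * p x y) := by
          rw [Real.one_rpow, one_div, ← Real.rpow_neg hd.le]; congr 1; ring
        _ ≤ _ := Real.rpow_le_rpow_of_exponent_le (not_lt.1 h) (by nlinarith [hs.1])
  rw [not_and_or, not_not, not_not] at hxy
  rcases hxy with h | h
  · refine le_trans (le_of_eq_of_le ?_ (main.trans (le_of_eq ?_))) le_self_add
    · rfl
    · simp [indicator_of_mem h]
  · refine le_trans (main.trans (le_of_eq ?_)) le_add_self
    simp [indicator_of_mem h]

lemma tent_mem {N : ℕ} (hN : 0 < N) {s : ℝ} (hs : s ∈ Set.Ioo (0:ℝ) 1) {p : Euc N → Euc N → ℝ}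
    (hp : ∀ x y, 1 ≤ p x y) : MemSob Set.univ s p (tent N) := by
  refine ⟨(tent_cont N).aestronglyMeasurable, ?_⟩
  unfold sobModular
  simp only [Measure.restrict_univ]
  set B := Metric.ball (0 : Euc N) 1
  have hB : volume B < ⊤ := measure_ball_lt_top
  have hBm : Measurable (B.indicator (1 : Euc N → ℝ≥0∞)) := measurable_one.indicator measurableSet_ball
  have hGm : Measurable (radG N s) := by
    unfold radG
    exact Measurable.ite measurableSet_Iio (by fun_prop) (by fun_prop)
  have hG : ∫⁻ z : Euc N, ENNReal.ofReal (radG N s ‖z‖) < ⊤ := by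
    have := (radG_int hN hs).lintegral_lt_top
    exact this
  set I := ∫⁻ z : Euc N, ENNReal.ofReal (radG N s ‖z‖) with hI
  rw [ENNReal.add_lt_top]
  constructor
  · have : ∀ x, ENNReal.ofReal (|tent N x| ^ p x x) ≤ B.indicator 1 x := by
      intro x
      have := hp x x
      by_cases hx : x ∈ B
      · rw [indicator_of_mem hx]
        simp only [Pi.one_apply]
        rw [ENNReal.ofReal_le_one]
        apply Real.rpow_le_one (abs_nonneg _) _ (by linarith)
        rw [abs_of_nonneg (tent_nonneg x)]; exact tent_le x
      · rw [tent_zero hx, abs_zero, Real.zero_rpow (by linarith)]; simp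
    refine (lintegral_mono this).trans_lt ?_
    rwa [lintegral_indicator_one measurableSet_ball]
  · have h1 : ∀ x : Euc N, ∫⁻ y : Euc N, ENNReal.ofReal (radG N s ‖x - y‖) = I := by
      intro x
      exact lintegral_sub_left_eq_self (fun z => ENNReal.ofReal (radG N s ‖z‖)) x
    have h2 : ∀ y : Euc N, ∫⁻ x : Euc N, ENNReal.ofReal (radG N s ‖x - y‖) = I := by
      intro y
      exact lintegral_sub_right_eq_self (fun z => ENNReal.ofReal (radG N s ‖z‖)) y
    have m1 : Measurable (fun z : Euc N × Euc N => B.indicator (1 : Euc N → ℝ≥0∞) z.1 *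
        ENNReal.ofReal (radG N s ‖z.1 - z.2‖)) :=
      (hBm.comp measurable_fst).mul (hGm.comp (by fun_prop)).ennreal_ofReal
    have m2 : Measurable (fun z : Euc N × Euc N => B.indicator (1 : Euc N → ℝ≥0∞) z.2 *
        ENNReal.ofReal (radG N s ‖z.1 - z.2‖)) :=
      (hBm.comp measurable_snd).mul (hGm.comp (by fun_prop)).ennreal_ofReal
    have mm : ∀ f : Euc N → Euc N, Measurable f → Measurable (fun y => ENNReal.ofReal (radG N s ‖f y‖)) :=
      fun f hf => (hGm.comp hf.norm).ennreal_ofReal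
    refine (lintegral_mono fun x => lintegral_mono fun y => tent_kernel hs hp x y).trans_lt ?_
    have e : ∀ x, ∫⁻ y, (B.indicator (1 : Euc N → ℝ≥0∞) x * ENNReal.ofReal (radG N s ‖x - y‖) +
        B.indicator 1 y * ENNReal.ofReal (radG N s ‖x - y‖)) =
        (∫⁻ y, B.indicator (1 : Euc N → ℝ≥0∞) x * ENNReal.ofReal (radG N s ‖x - y‖)) +
        ∫⁻ y, B.indicator 1 y * ENNReal.ofReal (radG N s ‖x - y‖) := fun x =>
      lintegral_add_left (m1.comp (measurable_prodMk_left (x := x))) _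
    rw [lintegral_congr e]
    rw [lintegral_add_left m1.lintegral_prod_right', ENNReal.add_lt_top]
    constructor
    · have : ∀ x, ∫⁻ y, B.indicator (1 : Euc N → ℝ≥0∞) x * ENNReal.ofReal (radG N s ‖x - y‖) =
          B.indicator 1 x * I := by
        intro x
        rw [lintegral_const_mul _ (mm _ (by fun_prop)), h1]
      rw [lintegral_congr this]
      rw [lintegral_mul_const _ hBm, lintegral_indicator_one measurableSet_ball]
      exact ENNReal.mul_lt_top hB hG
    · rw [lintegral_lintegral_swap m2.aemeasurable]
      have : ∀ y, ∫⁻ x, B.indicator (1 : Euc N → ℝ≥0∞) y * ENNReal.ofReal (radG N s ‖x - y‖) =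
          B.indicator 1 y * I := by
        intro x
        rw [lintegral_const_mul _ (mm _ (by fun_prop)), h2]
      rw [lintegral_congr this]
      rw [lintegral_mul_const _ hBm, lintegral_indicator_one measurableSet_ball]
      exact ENNReal.mul_lt_top hB hG

lemma tent_ne {N : ℕ} : ¬ tent N =ᵐ[volume] 0 := by
  intro h
  have := (tent_cont N).ae_eq_iff_eq volume continuous_zero |>.1 h
  have := congrFun this 0
  simp [tent] at this

/-- under (P₂) and (Q₂), the best imbedding constant S_q is
strictly positive. -/
theorem Sq_pos {N : ℕ}
    (s pminus pbar ε₀ : ℝ) (hs : s ∈ Set.Ioo (0 : ℝ) 1)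
    (p : Euc N → Euc N → ℝ) (pstar : Euc N → ℝ)
    (hpuc : UniformContinuous fun z : Euc N × Euc N => p z.1 z.2)
    (hpsym : ∀ x y, p x y = p y x)
    (hpminus : IsGLB (Set.range fun z : Euc N × Euc N => p z.1 z.2) pminus)
    (hpbar : IsLUB (Set.range fun z : Euc N × Euc N => p z.1 z.2) pbar)
    (hpm1 : 1 < pminus) (hpbarN : pbar < (N : ℝ) / s)
    (hε₀ : ε₀ ∈ Set.Ioo (0 : ℝ) (1 / 2))
    (hdiag : ∀ x y : Euc N, dist x y < ε₀ → p x y = pbar)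
    (hsupx : ∀ x : Euc N, IsLUB (Set.range (p x)) pbar)
    (hpstar : ∀ x : Euc N, IsGLB (Set.range (p x)) (pstar x))
    (hfin : volume {x : Euc N | pstar x ≠ pbar} < ⊤)
    (q : Euc N → ℝ) (hquc : UniformContinuous q)
    (pbarS : ℝ) (hpbarS : pbarS = (N : ℝ) * pbar / ((N : ℝ) - s * pbar))
    (hqlb : ∀ x, pstar x ≤ q x) (hqub : ∀ x, q x ≤ pbarS)
    (hqcrit : {x : Euc N | q x = pbarS}.Nonempty) :
    0 < Sq s p q := by
  have hs0 := hs.1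
  have hp1 : ∀ x y, 1 ≤ p x y := fun x y => hpm1.le.trans (hpminus.1 ⟨(x, y), rfl⟩)
  have hP : 1 < pbar := hpm1.trans_le
    ((hpminus.1 ⟨(0, 0), rfl⟩).trans (hpbar.1 ⟨(0, 0), rfl⟩))
  have hsP : s * pbar < N := by rw [lt_div_iff₀ hs0] at hpbarN; linarith
  have hN : 0 < N := by
    have : (0:ℝ) < N := lt_trans (by positivity) hsP
    exact_mod_cast this
  have hq1 : ∀ x, 1 ≤ q x := fun x => by
    refine le_trans ?_ (hqlb x)
    apply (le_isGLB_iff (hpstar x)).2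
    rintro _ ⟨y, rfl⟩
    exact hp1 x y
  have hpd : ∀ x, p x x = pbar := fun x => hdiag x x (by simpa using hε₀.1)
  obtain ⟨C, hC, H⟩ := frac_sob hN hs0 hP hsP hε₀.1 hpbarS
  set A := {x : Euc N | pstar x ≠ pbar} with hA
  set K : ℝ := (volume A).toReal + 1 + C with hK
  have hK1 : 1 ≤ K := by
    have : 0 ≤ (volume A).toReal := ENNReal.toReal_nonneg
    linarith
  have hK0 : 0 < K := by linarith
  -- modular bound
  have hmod : ∀ u : Euc N → ℝ, AEMeasurable u → sobModular univ s p u ≤ 1 →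
      varModular volume q u ≤ ENNReal.ofReal K := by
    intro u hu hle
    unfold sobModular at hle
    simp only [Measure.restrict_univ, hpd] at hle
    have hle' : (∫⁻ x, ENNReal.ofReal (|u x| ^ pbar)) + ∫⁻ x, locE s pbar ε₀ u x ≤ 1 := by
      refine le_trans (add_le_add le_rfl (lintegral_mono fun x => ?_)) hle
      unfold locE
      refine le_trans (le_of_eq ?_) (setLIntegral_le_lintegral (Metric.ball x ε₀) _)
      apply setLIntegral_congr_fun measurableSet_ball
      intro y hy
      simp only [sobKernel]
      rw [hdiag x y (by rw [dist_comm]; exact hy)]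
    have hQ := H u hu hle'
    have hPi : (∫⁻ x, ENNReal.ofReal (|u x| ^ pbar)) ≤ 1 := le_self_add.trans hle'
    have hpt : ∀ x, ENNReal.ofReal (|u x| ^ q x) ≤ (toMeasurable volume A).indicator 1 x +
        ENNReal.ofReal (|u x| ^ pbar) + ENNReal.ofReal (|u x| ^ pbarS) := by
      intro x
      rcases le_or_gt 1 |u x| with h | h
      · refine le_trans (ENNReal.ofReal_le_ofReal ?_) le_add_self
        exact Real.rpow_le_rpow_of_exponent_le h (hqub x)
      · refine le_trans ?_ le_self_add
        by_cases hx : x ∈ A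
        · refine le_trans ?_ le_self_add
          rw [indicator_of_mem (subset_toMeasurable _ _ hx)]
          simp only [Pi.one_apply]
          rw [ENNReal.ofReal_le_one]
          exact Real.rpow_le_one (abs_nonneg _) h.le (by linarith [hq1 x])
        · refine le_trans ?_ le_add_self
          have hx' : pstar x = pbar := by simpa [hA] using hx
          have := hqlb x
          apply ENNReal.ofReal_le_ofReal
          exact Real.rpow_le_rpow_of_exponent_ge' (abs_nonneg _) h.le (by linarith) (by linarith)
    have hum : AEMeasurable (fun x => |u x|) := measurable_norm.comp_aemeasurable hu
    calc varModular volume q u ≤ ∫⁻ x, ((toMeasurable volume A).indicator 1 x +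
        ENNReal.ofReal (|u x| ^ pbar) + ENNReal.ofReal (|u x| ^ pbarS)) := lintegral_mono hpt
      _ = volume A + (∫⁻ x, ENNReal.ofReal (|u x| ^ pbar)) +
          ∫⁻ x, ENNReal.ofReal (|u x| ^ pbarS) := by
          rw [lintegral_add_right' _ (hum.pow_const _).ennreal_ofReal,
            lintegral_add_right' _ (hum.pow_const _).ennreal_ofReal,
            lintegral_indicator_one (measurableSet_toMeasurable _ _), measure_toMeasurable]
      _ ≤ volume A + 1 + ENNReal.ofReal C := by gcongr
      _ = ENNReal.ofReal K := by
          rw [hK, ENNReal.ofReal_add (by positivity) hC.le,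
            ENNReal.ofReal_add (by positivity) zero_le_one, ENNReal.ofReal_toReal hfin.ne,
            ENNReal.ofReal_one]
  have hlow : ∀ b ∈ {c : ℝ | ∃ u : Euc N → ℝ, MemSob Set.univ s p u ∧ ¬ u =ᵐ[volume] 0 ∧
      c = sobNorm Set.univ s p u / luxNorm volume q u}, 1 / K ≤ b := by
    rintro b ⟨u, ⟨hum, hufin⟩, hu0, rfl⟩
    have hu : AEMeasurable u := by simpa using hum.aemeasurable
    -- transfer
    have htr : ∀ c : ℝ, 0 < c → sobModular univ s p (fun x => u x / c) ≤ 1 →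
        varModular volume q (fun x => u x / (K * c)) ≤ 1 := by
      intro c hc h
      have h1 := hmod _ (hu.div_const c) h
      have h2 := varModular_div_le volume hq1 (fun x => u x / c) hK1
      simp only [div_div, mul_comm c K] at h2
      refine h2.trans ?_
      calc _ ≤ ENNReal.ofReal (1 / K) * ENNReal.ofReal K := by gcongr
        _ = 1 := by
          rw [← ENNReal.ofReal_mul (by positivity), one_div_mul_cancel hK0.ne', ENNReal.ofReal_one]
    have hne : {c : ℝ | 0 < c ∧ sobModular univ s p (fun x => u x / c) ≤ 1}.Nonempty := by
      set m := (sobModular univ s p u).toReal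
      have hm0 : 0 ≤ m := ENNReal.toReal_nonneg
      refine ⟨1 + m, by positivity, ?_⟩
      refine (sobModular_div_le univ s hp1 u (by linarith : (1:ℝ) ≤ 1 + m)).trans ?_
      rw [← ENNReal.ofReal_toReal hufin.ne, ← ENNReal.ofReal_mul (by positivity),
        ENNReal.ofReal_le_one, one_div_mul_eq_div, div_le_one (by positivity)]
      linarith
    have hbdd : BddBelow {c : ℝ | 0 < c ∧ varModular volume q (fun x => u x / c) ≤ 1} :=
      ⟨0, fun c hc => hc.1.le⟩
    have hle : luxNorm volume q u ≤ K * sobNorm univ s p u := by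
      have : luxNorm volume q u / K ≤ sobNorm univ s p u := by
        apply le_csInf hne
        rintro c ⟨hc, h⟩
        rw [div_le_iff₀ hK0, mul_comm]
        exact csInf_le hbdd ⟨by positivity, htr c hc h⟩
      rw [div_le_iff₀ hK0] at this
      linarith
    have hpos : 0 < luxNorm volume q u := by
      obtain ⟨c₀, hc₀, hc₀'⟩ := hne
      set V := varModular volume q u with hV
      have hV0 : V ≠ 0 := by
        intro h
        rw [hV, varModular, lintegral_eq_zero_iff'] at h
        · apply hu0
          filter_upwards [h] with x hx
          simp only [Pi.zero_apply, ENNReal.ofReal_eq_zero] at hx ⊢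
          by_contra hne
          have : 0 < |u x| ^ q x := Real.rpow_pos_of_pos (abs_pos.2 hne) _
          linarith
        · exact ((measurable_norm.comp_aemeasurable hu).pow
            hquc.continuous.measurable.aemeasurable).ennreal_ofReal
      have hstep : ∀ c : ℝ, 0 < c → c ≤ 1 → varModular volume q (fun x => u x / c) ≤ 1 →
          V ≤ ENNReal.ofReal c := by
        intro c hc hc1 h
        have h2 := varModular_div_le volume hq1 (fun x => u x / c) (one_le_one_div hc hc1)
        have e : (fun x => u x / c / (1 / c)) = u := by
          ext x; field_simp
        rw [e, one_div_one_div] at h2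
        calc V ≤ _ := h2
          _ ≤ ENNReal.ofReal c * 1 := by gcongr
          _ = _ := mul_one _
      have hmin : 0 < (min 1 V).toReal :=
        ENNReal.toReal_pos (by simp [hV0]) (by simp)
      refine hmin.trans_le ?_
      refine le_csInf (s := {c : ℝ | 0 < c ∧ varModular volume q (fun x => u x / c) ≤ 1})
        ⟨K * c₀, by positivity, htr c₀ hc₀ hc₀'⟩ ?_
      rintro c ⟨hc, h⟩
      apply ENNReal.toReal_le_of_le_ofReal hc.le
      rcases le_or_gt c 1 with h1 | h1
      · exact (min_le_right _ _).trans (hstep c hc h1 h)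
      · exact (min_le_left _ _).trans (by rw [ENNReal.one_le_ofReal]; exact h1.le)
    rw [le_div_iff₀ hpos, one_div_mul_eq_div, div_le_iff₀ hK0]
    linarith
  refine lt_of_lt_of_le (by positivity : 0 < 1 / K) ?_
  unfold Sq
  refine le_csInf ?_ hlow
  exact ⟨_, tent N, tent_mem hN hs hp1, tent_ne, rfl⟩
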